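/- Let α ∈ (1,2] and let γ be a probability measure on [1,∞) that is a fixed point of the α-recursive distributional equation, and define its Laplace-type transform φ(ℓ) = ∫ e^{−ℓs/2} γ(ds) for ℓ ≥ 0. Then φ is twice continuously differentiable on (0,∞) and solves the differential equation 2ℓ·φ″(ℓ) + ℓ·φ′(ℓ) + ((1−φ(ℓ))^α + φ(ℓ) − 1)/(α−1) = 0 for every ℓ > 0 (for α = 2 this reads 2ℓ·φ″(ℓ) + ℓ·φ′(ℓ) + φ(ℓ)² − φ(ℓ) = 0). -/

import Mathlib

open MeasureTheory

/-- The α-offspring distribution: θ_α(k) = α(2−α)(3−α)⋯(k−1−α)/k! for k ≥ 2, and 0 else. -/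
noncomputable def thetaDist (α : ℝ) (k : ℕ) : ℝ :=
  if 2 ≤ k then α * (∏ i ∈ Finset.Icc 2 (k - 1), ((i : ℝ) - α)) / (Nat.factorial k : ℝ) else 0

/-- The uniform distribution on [0,1]. -/
noncomputable def unifMeasure : Measure ℝ := volume.restrict (Set.Icc 0 1)

/-- The map on measures associated with the α-recursive distributional equation:
the law of G(U,N,(X₁,…,X_N)) = (U + (1−U)/(X₁+⋯+X_N))⁻¹ where U is uniform on [0,1],
N ~ θ_α and the X_i are i.i.d. with law γ, all independent (decomposed according to
the value of N). -/
noncomputable def rdeMap (α : ℝ) (γ : Measure ℝ) : Measure ℝ :=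
  Measure.sum fun k : ℕ =>
    ENNReal.ofReal (thetaDist α k) •
      Measure.map (fun p : ℝ × (Fin k → ℝ) => (p.1 + (1 - p.1) / ∑ i, p.2 i)⁻¹)
        (unifMeasure.prod (Measure.pi fun _ : Fin k => γ))

/-- γ is a probability measure on [1,∞) that is a fixed point of the α-recursive
distributional equation. -/
def IsRDEFixedPoint (α : ℝ) (γ : Measure ℝ) : Prop :=
  IsProbabilityMeasure γ ∧ γ (Set.Iio 1) = 0 ∧ rdeMap α γ = γ

/-- The Laplace-type transform φ(ℓ) = ∫ e^{−ℓs/2} γ(ds). -/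
noncomputable def laplaceT (γ : Measure ℝ) (ℓ : ℝ) : ℝ :=
  ∫ s, Real.exp (-ℓ * s / 2) ∂γ

theorem thetaDist_mul_sub_one (α : ℝ) (n : ℕ) :
    thetaDist α (n + 2) * (α - 1) = (-1) ^ (n + 2) * Ring.choose α (n + 2) := by
  have hchoose := Ring.descPochhammer_eq_factorial_smul_choose α (n + 2)
  have hprod : (descPochhammer ℤ (n + 2)).smeval α * (-1) ^ (n + 2) =
      α * (α - 1) * ∏ i ∈ Finset.Icc 2 (n + 1), ((i : ℝ) - α) := by
    clear hchoose
    induction n with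
    | zero => simp [descPochhammer_succ_right, Polynomial.smeval_mul, Polynomial.smeval_sub,
        Polynomial.smeval_X]
    | succ n ih =>
      rw [Finset.prod_Icc_succ_top (by omega), ← mul_assoc, ← ih, descPochhammer_succ_right,
        Polynomial.smeval_mul]
      simp only [Polynomial.smeval_sub, Polynomial.smeval_X, Polynomial.smeval_natCast]
      push_cast
      simp
      ring
  have hfact : ((n + 2).factorial : ℝ) ≠ 0 := by positivity
  rw [hchoose, nsmul_eq_mul] at hprod
  simp only [thetaDist, le_add_iff_nonneg_left, zero_le, if_true, Nat.add_succ_sub_one]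
  field_simp
  linear_combination -hprod

theorem thetaDist_nonneg {α : ℝ} (hα : α ∈ Set.Ioc (1 : ℝ) 2) (k : ℕ) : 0 ≤ thetaDist α k := by
  unfold thetaDist
  split_ifs with hk
  · have hprod : 0 ≤ ∏ i ∈ Finset.Icc 2 (k - 1), ((i : ℝ) - α) := by
      refine Finset.prod_nonneg fun i hi => ?_
      have : (2 : ℝ) ≤ i := by exact_mod_cast (Finset.mem_Icc.1 hi).1
      linarith [hα.2]
    have : 0 ≤ α := by linarith [hα.1]
    positivity
  · exact le_rfl

/-- The probability generating function of the offspring distribution. -/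
theorem hasSum_thetaDist_mul_pow {α : ℝ} (hα : 1 < α) {s : ℝ} (hs : |s| < 1) :
    HasSum (fun k => thetaDist α k * s ^ k) (((1 - s) ^ α - 1 + α * s) / (α - 1)) := by
  have h := (Real.one_add_rpow_hasFPowerSeriesOnBall_zero (a := α)).hasSum (y := -s)
    (by simpa [← ofReal_norm, ENNReal.ofReal_lt_one] using hs)
  simp only [binomialSeries_apply, List.ofFn_const, List.prod_replicate, smul_eq_mul,
    zero_add] at h
  rw [← hasSum_nat_add_iff' 2] at h ⊢
  have hα' : α - 1 ≠ 0 := by linarith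
  convert! h.div_const (α - 1) using 1
  · funext n
    rw [eq_div_iff hα', mul_right_comm, thetaDist_mul_sub_one, neg_pow s]
    ring
  · simp [Finset.sum_range_succ, thetaDist]
    ring_nf

theorem hasDerivAt_one_sub_mul_exp {S u : ℝ} (ℓ : ℝ) (hv : u + (1 - u) / S ≠ 0) (hS : S ≠ 0) :
    HasDerivAt (fun u => -(1 - u) * Real.exp (-ℓ * (u + (1 - u) / S)⁻¹ / 2))
      (Real.exp (-ℓ * (u + (1 - u) / S)⁻¹ / 2) *
        (1 - ℓ / 2 * ((u + (1 - u) / S)⁻¹ ^ 2 - (u + (1 - u) / S)⁻¹))) u := by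
  have h1 : HasDerivAt (fun u : ℝ => 1 - u) (-1) u := (hasDerivAt_id u).const_sub 1
  have hV : HasDerivAt (fun u : ℝ => u + (1 - u) / S) (1 + -1 / S) u :=
    (hasDerivAt_id u).add (h1.div_const S)
  have h := h1.neg.mul (((hV.inv hv).const_mul (-ℓ)).div_const 2).exp
  refine h.congr_deriv ?_
  simp only [Pi.neg_apply, Pi.inv_apply]
  generalize hE : Real.exp _ = E
  obtain ⟨v, hvd⟩ : ∃ v, v = u + (1 - u) / S := ⟨_, rfl⟩
  have key : (1 - u) * (S - 1) = S * (1 - v) := by rw [hvd]; field_simp; ring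
  rw [← hvd] at hv ⊢
  field_simp
  linear_combination (-ℓ * E) * key

/-- The function `f` for which `E[f(X)]` is `E[exp (-ℓ S / 2)]`, when `1 / X` is uniform on
`[1 / S, 1]`. -/
noncomputable def laplaceTest (ℓ x : ℝ) : ℝ :=
  Real.exp (-ℓ * x / 2) * (1 - ℓ / 2 * (x ^ 2 - x))

theorem continuous_laplaceTest (ℓ : ℝ) : Continuous (laplaceTest ℓ) := by
  unfold laplaceTest
  fun_prop

theorem integral_laplaceTest_unifMeasure (ℓ : ℝ) {S : ℝ} (hS : 0 < S) :
    ∫ u, laplaceTest ℓ (u + (1 - u) / S)⁻¹ ∂unifMeasure = Real.exp (-ℓ * S / 2) := by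
  have hv : ∀ u ∈ Set.uIcc (0 : ℝ) 1, u + (1 - u) / S ≠ 0 := by
    intro u hu
    rw [Set.uIcc_of_le zero_le_one] at hu
    rcases hu.1.eq_or_lt with rfl | hu0
    · simp [hS.ne']
    · have : 0 ≤ (1 - u) / S := div_nonneg (by linarith [hu.2]) hS.le
      linarith
  rw [unifMeasure, integral_Icc_eq_integral_Ioc, ← intervalIntegral.integral_of_le zero_le_one,
    intervalIntegral.integral_eq_sub_of_hasDerivAt (f' := fun u =>
      laplaceTest ℓ (u + (1 - u) / S)⁻¹)
      (fun u hu => hasDerivAt_one_sub_mul_exp ℓ (hv u hu) hS.ne')]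
  · simp
  · refine ContinuousOn.intervalIntegrable ?_
    refine (continuous_laplaceTest ℓ).comp_continuousOn (ContinuousOn.inv₀ ?_ hv)
    fun_prop

theorem ae_pi_sum_pos {γ : Measure ℝ} [SigmaFinite γ] (hγ : ∀ᵐ x ∂γ, 1 ≤ x) {k : ℕ} (hk : 0 < k) :
    ∀ᵐ x ∂Measure.pi fun _ : Fin k => γ, 0 < ∑ i, x i := by
  have h : ∀ᵐ x ∂Measure.pi fun _ : Fin k => γ, ∀ i, 1 ≤ x i :=
    ae_all_iff.2 fun i => (Measure.quasiMeasurePreserving_eval (μ := fun _ => γ) i).ae hγ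
  filter_upwards [h] with x hx
  have : Nonempty (Fin k) := ⟨⟨0, hk⟩⟩
  exact Finset.sum_pos (fun i _ => by linarith [hx i]) Finset.univ_nonempty

theorem integral_exp_sum_pi (γ : Measure ℝ) [SigmaFinite γ] (ℓ : ℝ) (k : ℕ) :
    ∫ x, Real.exp (-ℓ * (∑ i, x i) / 2) ∂(Measure.pi fun _ : Fin k => γ) = laplaceT γ ℓ ^ k := by
  have h := integral_fintype_prod_eq_pow (ι := Fin k) (μ := γ) fun x => Real.exp (-ℓ * x / 2)
  simpa only [laplaceT, ← Real.exp_sum, ← Finset.mul_sum, ← Finset.sum_div, Fintype.card_fin] using h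

theorem hasSum_integral_laplaceTest {α : ℝ} (hα : α ∈ Set.Ioc (1 : ℝ) 2) {γ : Measure ℝ}
    [IsProbabilityMeasure γ] (hγ : ∀ᵐ x ∂γ, 1 ≤ x) {ℓ : ℝ}
    (hint : Integrable (laplaceTest ℓ) (rdeMap α γ)) :
    HasSum (fun k => thetaDist α k * laplaceT γ ℓ ^ k) (∫ x, laplaceTest ℓ x ∂rdeMap α γ) := by
  refine (hasSum_integral_measure hint).congr_fun fun k => ?_
  rcases eq_or_ne (thetaDist α k) 0 with h0 | h0
  · simp [h0]
  have hk : 0 < k := by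
    rcases Nat.eq_zero_or_pos k with rfl | hk
    · simp [thetaDist] at h0
    · exact hk
  have hpos : 0 < thetaDist α k := (thetaDist_nonneg hα k).lt_of_ne' h0
  have : SFinite unifMeasure := by unfold unifMeasure; infer_instance
  have hG : Measurable fun p : ℝ × (Fin k → ℝ) => (p.1 + (1 - p.1) / ∑ i, p.2 i)⁻¹ := by fun_prop
  have hmeas := (continuous_laplaceTest ℓ).aestronglyMeasurable (μ := Measure.map
    (fun p : ℝ × (Fin k → ℝ) => (p.1 + (1 - p.1) / ∑ i, p.2 i)⁻¹)
    (unifMeasure.prod (Measure.pi fun _ : Fin k => γ)))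
  have hintk := hint.mono_measure (Measure.le_sum _ k)
  rw [integrable_smul_measure (by simpa using hpos) ENNReal.ofReal_ne_top,
    integrable_map_measure hmeas hG.aemeasurable, Function.comp_def] at hintk
  rw [integral_smul_measure, integral_map hG.aemeasurable hmeas, integral_prod_symm _ hintk,
    ENNReal.toReal_ofReal hpos.le, smul_eq_mul, ← integral_exp_sum_pi]
  congr 1
  refine integral_congr_ae ?_
  filter_upwards [ae_pi_sum_pos hγ hk] with x hx
  exact (integral_laplaceTest_unifMeasure ℓ hx).symm

theorem laplaceT_eq_mgf (γ : Measure ℝ) (ℓ : ℝ) :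
    laplaceT γ ℓ = ProbabilityTheory.mgf id γ (-ℓ / 2) := by
  simp only [laplaceT, ProbabilityTheory.mgf, id]
  congr! 3
  ring

section Derivatives

open ProbabilityTheory

variable {γ : Measure ℝ} [IsProbabilityMeasure γ]

theorem mem_interior_integrableExpSet (hγ : ∀ᵐ x ∂γ, 1 ≤ x) {t : ℝ} (ht : t < 0) :
    t ∈ interior (integrableExpSet id γ) := by
  refine interior_mono (s := Set.Iio 0) (fun t ht => ?_) (by simpa using ht)
  refine Integrable.of_bound (C := 1) (by fun_prop) ?_
  filter_upwards [hγ] with x hx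
  rw [Real.norm_eq_abs, Real.abs_exp, Real.exp_le_one_iff]
  exact mul_nonpos_of_nonpos_of_nonneg (le_of_lt ht) (zero_le_one.trans hx)

theorem hasDerivAt_integral_pow_mul_exp (hγ : ∀ᵐ x ∂γ, 1 ≤ x) {ℓ : ℝ} (hℓ : 0 < ℓ) (n : ℕ) :
    HasDerivAt (fun ℓ => ∫ x, x ^ n * Real.exp (-ℓ / 2 * x) ∂γ)
      (-(1 / 2) * ∫ x, x ^ (n + 1) * Real.exp (-ℓ / 2 * x) ∂γ) ℓ := by
  have h := hasDerivAt_integral_pow_mul_exp_real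
    (mem_interior_integrableExpSet hγ (t := -ℓ / 2) (by linarith)) n
  have h2 : HasDerivAt (fun ℓ : ℝ => -ℓ / 2) (-1 / 2) ℓ := (hasDerivAt_id ℓ).neg.div_const 2
  refine (h.comp ℓ h2).congr_deriv ?_
  simp only [id]
  ring

theorem integrable_pow_mul_exp (hγ : ∀ᵐ x ∂γ, 1 ≤ x) {ℓ : ℝ} (hℓ : 0 < ℓ) (n : ℕ) :
    Integrable (fun x => x ^ n * Real.exp (-ℓ / 2 * x)) γ :=
  integrable_pow_mul_exp_of_mem_interior_integrableExpSet
    (mem_interior_integrableExpSet hγ (t := -ℓ / 2) (by linarith)) n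

theorem laplaceT_eq_integral_pow_zero (γ : Measure ℝ) :
    laplaceT γ = fun ℓ => ∫ x, x ^ 0 * Real.exp (-ℓ / 2 * x) ∂γ := by
  funext ℓ
  rw [laplaceT]
  congr! 2 with x
  rw [pow_zero, one_mul]
  ring_nf

theorem deriv_laplaceT (hγ : ∀ᵐ x ∂γ, 1 ≤ x) {ℓ : ℝ} (hℓ : 0 < ℓ) :
    deriv (laplaceT γ) ℓ = -(1 / 2) * ∫ x, x ^ 1 * Real.exp (-ℓ / 2 * x) ∂γ := by
  rw [laplaceT_eq_integral_pow_zero]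
  exact (hasDerivAt_integral_pow_mul_exp hγ hℓ 0).deriv

theorem deriv_deriv_laplaceT (hγ : ∀ᵐ x ∂γ, 1 ≤ x) {ℓ : ℝ} (hℓ : 0 < ℓ) :
    deriv (deriv (laplaceT γ)) ℓ = 1 / 4 * ∫ x, x ^ 2 * Real.exp (-ℓ / 2 * x) ∂γ := by
  have h : deriv (laplaceT γ) =ᶠ[nhds ℓ]
      fun ℓ => -(1 / 2) * ∫ x, x ^ 1 * Real.exp (-ℓ / 2 * x) ∂γ :=
    (eventually_gt_nhds hℓ).mono fun _ => deriv_laplaceT hγ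
  rw [h.deriv_eq, ((hasDerivAt_integral_pow_mul_exp hγ hℓ 1).const_mul _).deriv]
  ring

theorem contDiffOn_laplaceT (hγ : ∀ᵐ x ∂γ, 1 ≤ x) {n : WithTop ℕ∞} :
    ContDiffOn ℝ n (laplaceT γ) (Set.Ioi 0) := by
  have h : laplaceT γ = fun ℓ => mgf id γ (-ℓ / 2) := funext (laplaceT_eq_mgf γ)
  rw [h]
  intro ℓ hℓ
  have hmgf : ContDiffAt ℝ n (mgf id γ) (-ℓ / 2) :=
    (analyticAt_mgf (mem_interior_integrableExpSet hγ
      (by linarith [Set.mem_Ioi.1 hℓ]))).contDiffAt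
  exact (hmgf.comp ℓ (f := fun ℓ => -ℓ / 2) (by fun_prop)).contDiffWithinAt

theorem laplaceTest_eq (ℓ x : ℝ) :
    laplaceTest ℓ x = x ^ 0 * Real.exp (-ℓ / 2 * x) -
      ℓ / 2 * (x ^ 2 * Real.exp (-ℓ / 2 * x) - x ^ 1 * Real.exp (-ℓ / 2 * x)) := by
  rw [laplaceTest, mul_div_right_comm]
  ring

theorem integrable_laplaceTest (hγ : ∀ᵐ x ∂γ, 1 ≤ x) {ℓ : ℝ} (hℓ : 0 < ℓ) :
    Integrable (laplaceTest ℓ) γ := by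
  have h := integrable_pow_mul_exp hγ hℓ
  rw [funext (laplaceTest_eq ℓ)]
  exact (h 0).sub (((h 2).sub (h 1)).const_mul (ℓ / 2))

theorem integral_laplaceTest (hγ : ∀ᵐ x ∂γ, 1 ≤ x) {ℓ : ℝ} (hℓ : 0 < ℓ) :
    ∫ x, laplaceTest ℓ x ∂γ =
      laplaceT γ ℓ - 2 * ℓ * deriv (deriv (laplaceT γ)) ℓ - ℓ * deriv (laplaceT γ) ℓ := by
  have h := integrable_pow_mul_exp hγ hℓ
  simp only [laplaceTest_eq]
  have h21 : Integrable (fun x => ℓ / 2 * (x ^ 2 * Real.exp (-ℓ / 2 * x) -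
      x ^ 1 * Real.exp (-ℓ / 2 * x))) γ := ((h 2).sub (h 1)).const_mul _
  rw [integral_sub (h 0) h21, integral_const_mul, integral_sub (h 2) (h 1), deriv_deriv_laplaceT hγ hℓ, deriv_laplaceT hγ hℓ,
    laplaceT_eq_integral_pow_zero]
  ring

theorem laplaceT_mem_Ico (hγ : ∀ᵐ x ∂γ, 1 ≤ x) {ℓ : ℝ} (hℓ : 0 < ℓ) :
    laplaceT γ ℓ ∈ Set.Ico (0 : ℝ) 1 := by
  refine ⟨integral_nonneg fun x => (Real.exp_pos _).le, ?_⟩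
  have hle : laplaceT γ ℓ ≤ ∫ _, Real.exp (-ℓ / 2) ∂γ := by
    rw [laplaceT_eq_integral_pow_zero]
    refine integral_mono_ae (integrable_pow_mul_exp hγ hℓ 0) (integrable_const _) ?_
    filter_upwards [hγ] with x hx
    simp only [pow_zero, one_mul, Real.exp_le_exp]
    nlinarith
  refine hle.trans_lt ?_
  simp only [integral_const, probReal_univ, one_smul, Real.exp_lt_one_iff]
  linarith

end Derivatives

/-- For a fixed point γ of the α-RDE, the Laplace transform φ is C² on (0,∞) and
solves 2ℓφ″(ℓ) + ℓφ′(ℓ) + ((1−φ(ℓ))^α + φ(ℓ) − 1)/(α−1) = 0 for ℓ > 0. -/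
theorem laplace_transform_ode (α : ℝ) (hα : α ∈ Set.Ioc (1 : ℝ) 2)
    (γ : Measure ℝ) (hγ : IsRDEFixedPoint α γ) :
    ContDiffOn ℝ 2 (laplaceT γ) (Set.Ioi 0) ∧
    ∀ ℓ : ℝ, 0 < ℓ →
      2 * ℓ * deriv (deriv (laplaceT γ)) ℓ + ℓ * deriv (laplaceT γ) ℓ +
        ((1 - laplaceT γ ℓ) ^ α + laplaceT γ ℓ - 1) / (α - 1) = 0 := by
  obtain ⟨hprob, hsupp, hfix⟩ := hγ
  have hae : ∀ᵐ x ∂γ, 1 ≤ x := by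
    rw [ae_iff]
    simp only [not_le]
    exact hsupp
  refine ⟨contDiffOn_laplaceT hae, fun ℓ hℓ => ?_⟩
  obtain ⟨h0, h1⟩ := laplaceT_mem_Ico hae hℓ
  have hsum := hasSum_integral_laplaceTest hα hae
    (hfix.symm ▸ integrable_laplaceTest hae hℓ : Integrable (laplaceTest ℓ) (rdeMap α γ))
  rw [hfix, integral_laplaceTest hae hℓ] at hsum
  have hgf := hsum.unique
    (hasSum_thetaDist_mul_pow hα.1 (abs_lt.2 ⟨by linarith, h1⟩))
  have hα' : α - 1 ≠ 0 := sub_ne_zero.2 hα.1.ne'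
  rw [eq_div_iff hα'] at hgf
  field_simp
  linear_combination -hgf
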